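/- arXiv:2604.05460 — 2 statements merged into one kernel-verified Lean document; each statement's English description precedes it below -/
import Mathlib

section
/- Let m ≥ 2 and ε₁,…,ε_m ∈ [0,1]. Then Σ_{S ⊆ {1,…,m}, |S| ≥ 2} Π_{j∈S} ε_j ≤ 2^{m−2} · Σ_{1≤a<b≤m} ε_a ε_b. -/
lemma Finset.prod_le_prod_of_subset_of_mem_Icc {ι : Type*} [DecidableEq ι] {s t : Finset ι}
    (hst : s ⊆ t) {f : ι → ℝ} (hf : ∀ i ∈ t, f i ∈ Set.Icc (0 : ℝ) 1) :
    ∏ i ∈ t, f i ≤ ∏ i ∈ s, f i := by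
  rw [← Finset.prod_sdiff hst]
  refine mul_le_of_le_one_left (Finset.prod_nonneg fun i hi => (hf i (hst hi)).1) ?_
  exact Finset.prod_le_one (fun i hi => (hf i (Finset.sdiff_subset hi)).1)
    fun i hi => (hf i (Finset.sdiff_subset hi)).2

lemma Finset.exists_lt_pair_subset {ι : Type*} [LinearOrder ι] {s : Finset ι} (hs : 2 ≤ s.card) :
    ∃ a b, a < b ∧ ({a, b} : Finset ι) ⊆ s := by
  obtain ⟨a, ha, b, hb, hab⟩ := Finset.one_lt_card.mp hs
  rcases lt_or_gt_of_ne hab with h | h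
  · exact ⟨a, b, h, by simp [Finset.insert_subset_iff, ha, hb]⟩
  · exact ⟨b, a, h, by simp [Finset.insert_subset_iff, ha, hb]⟩

lemma Finset.card_filter_pair_subset {ι : Type*} [Fintype ι] [DecidableEq ι] {a b : ι}
    (hab : a ≠ b) :
    (Finset.univ.filter fun s : Finset ι => {a, b} ⊆ s).card = 2 ^ (Fintype.card ι - 2) := by
  have h : (Finset.univ.filter fun s : Finset ι => {a, b} ⊆ s) = Finset.Icc {a, b} Finset.univ := by
    ext s
    simp
  rw [h, Finset.card_Icc_finset (Finset.subset_univ _), Finset.card_pair hab, Finset.card_univ]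

/-- **Combinatorial quadratic-leakage inequality.** For `ε₁,…,ε_m ∈ [0,1]`,
`Σ_{|S|≥2} Π_{j∈S} ε_j ≤ 2^{m−2} · Σ_{a<b} ε_a ε_b`. -/
theorem stmt12 (m : ℕ) (hm : 2 ≤ m) (ε : Fin m → ℝ)
    (hε : ∀ j : Fin m, ε j ∈ Set.Icc (0 : ℝ) 1) :
    (∑ S ∈ Finset.univ.filter (fun S : Finset (Fin m) => 2 ≤ S.card),
        ∏ j ∈ S, ε j)
      ≤ (2 : ℝ) ^ (m - 2) *
          ∑ a : Fin m, ∑ b : Fin m, if a < b then ε a * ε b else 0 := by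
  let P : Finset (Fin m × Fin m) := Finset.univ.filter fun p => p.1 < p.2
  have hnonneg (p : Fin m × Fin m) : 0 ≤ ε p.1 * ε p.2 := mul_nonneg (hε _).1 (hε _).1
  have hprod (S : Finset (Fin m)) (hS : 2 ≤ S.card) :
      ∏ j ∈ S, ε j ≤ ∑ p ∈ P, if {p.1, p.2} ⊆ S then ε p.1 * ε p.2 else 0 := by
    obtain ⟨a, b, hab, hsub⟩ := Finset.exists_lt_pair_subset hS
    calc ∏ j ∈ S, ε j ≤ ∏ j ∈ {a, b}, ε j :=
          Finset.prod_le_prod_of_subset_of_mem_Icc hsub fun j _ => hε j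
      _ = if {a, b} ⊆ S then ε a * ε b else 0 := by rw [if_pos hsub, Finset.prod_pair hab.ne]
      _ ≤ _ := Finset.single_le_sum
          (f := fun p : Fin m × Fin m => if {p.1, p.2} ⊆ S then ε p.1 * ε p.2 else 0)
          (fun p _ => ite_nonneg (hnonneg p) le_rfl) (a := (a, b)) (by simpa [P] using hab)
  calc ∑ S ∈ Finset.univ.filter (fun S : Finset (Fin m) => 2 ≤ S.card), ∏ j ∈ S, ε j
      ≤ ∑ S ∈ Finset.univ.filter (fun S : Finset (Fin m) => 2 ≤ S.card),
          ∑ p ∈ P, if {p.1, p.2} ⊆ S then ε p.1 * ε p.2 else 0 :=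
        Finset.sum_le_sum fun S hS => hprod S (Finset.mem_filter.mp hS).2
    _ ≤ ∑ S : Finset (Fin m), ∑ p ∈ P, if {p.1, p.2} ⊆ S then ε p.1 * ε p.2 else 0 :=
        Finset.sum_le_sum_of_subset_of_nonneg (Finset.filter_subset _ _) fun S _ _ =>
          Finset.sum_nonneg fun p _ => ite_nonneg (hnonneg p) le_rfl
    _ = ∑ p ∈ P, (2 : ℝ) ^ (m - 2) * (ε p.1 * ε p.2) := by
        rw [Finset.sum_comm]
        refine Finset.sum_congr rfl fun p hp => ?_
        rw [← Finset.sum_filter, Finset.sum_const,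
          Finset.card_filter_pair_subset (Finset.mem_filter.mp hp).2.ne, Fintype.card_fin,
          nsmul_eq_mul, Nat.cast_pow, Nat.cast_ofNat]
    _ = _ := by rw [← Finset.mul_sum, Finset.sum_filter, Fintype.sum_prod_type]
end

section
/- Let n ≥ 1, α₀ > 0, and let X₁,…,X_n ∈ ℝ^{d₁×d₂}, y₁,…,y_n ∈ ℝ. Define σ(x) = 1/(1+e^{−x}) and the loss L(M) = (1/n)·Σ_{t=1}^n [log(1 + e^{⟨X_t,M⟩}) − y_t⟨X_t,M⟩], where ⟨X,M⟩ = Σ_{i,j} X_{ij}M_{ij}. Let M*, Δ ∈ ℝ^{d₁×d₂} satisfy |⟨X_t, M*⟩| ≤ 2α₀ and |⟨X_t, M* + Δ⟩| ≤ 2α₀ for every t. Then L(M* + Δ) − L(M*) − (1/n)·Σ_{t=1}^n (σ(⟨X_t,M*⟩) − y_t)·⟨X_t,Δ⟩ ≥ (c_{α₀}/(2n))·Σ_{t=1}^n ⟨X_t,Δ⟩², where c_{α₀} = e^{2α₀}/(1+e^{2α₀})² is the minimum of σ' on [−2α₀, 2α₀]. -/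
/-- The trace inner product `⟨X, M⟩ = Σ_{i,j} X_{ij} M_{ij}` on `ℝ^{d₁×d₂}`. -/
noncomputable def mip {d₁ d₂ : ℕ} (X M : Matrix (Fin d₁) (Fin d₂) ℝ) : ℝ :=
  ∑ i : Fin d₁, ∑ j : Fin d₂, X i j * M i j

/-- The empirical pairwise-logistic loss
`L(M) = (1/n)·Σ_t [log(1 + e^{⟨X_t,M⟩}) − y_t⟨X_t,M⟩]`. -/
noncomputable def logloss {d₁ d₂ n : ℕ} (X : Fin n → Matrix (Fin d₁) (Fin d₂) ℝ)
    (y : Fin n → ℝ) (M : Matrix (Fin d₁) (Fin d₂) ℝ) : ℝ :=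
  (1 / (n : ℝ)) *
    ∑ t : Fin n, (Real.log (1 + Real.exp (mip (X t) M)) - y t * mip (X t) M)

/-- The logistic sigmoid `σ(x) = 1/(1+e^{-x})`. -/
noncomputable def lsig (x : ℝ) : ℝ := 1 / (1 + Real.exp (-x))

theorem mip_add {d₁ d₂ : ℕ} (X M N : Matrix (Fin d₁) (Fin d₂) ℝ) :
    mip X (M + N) = mip X M + mip X N := by
  simp [mip, mul_add, Finset.sum_add_distrib]

/-- The tangent-line inequality for convex functions. -/
theorem ConvexOn.add_mul_sub_le_of_hasDerivAt {S : Set ℝ} {f : ℝ → ℝ} {f' a b : ℝ}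
    (hf : ConvexOn ℝ S f) (ha : a ∈ S) (hb : b ∈ S) (hd : HasDerivAt f f' a) :
    f a + f' * (b - a) ≤ f b := by
  rcases lt_trichotomy a b with h | rfl | h
  · have := hf.le_slope_of_hasDerivAt ha hb h hd
    rw [slope_def_field, le_div_iff₀ (sub_pos.2 h)] at this
    linarith
  · simp
  · have := hf.slope_le_of_hasDerivAt hb ha h hd
    rw [slope_def_field, div_le_iff₀ (sub_pos.2 h)] at this
    linarith

/-- A second-order lower bound from a lower bound on the second derivative. -/
theorem half_mul_sq_le_of_le_deriv2 {S : Set ℝ} (hS : Convex ℝ S) {f f' f'' : ℝ → ℝ} {c a b : ℝ}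
    (hf : ∀ x, HasDerivAt f (f' x) x) (hf' : ∀ x, HasDerivAt f' (f'' x) x)
    (hc : ∀ x ∈ S, c ≤ f'' x) (ha : a ∈ S) (hb : b ∈ S) :
    c / 2 * (b - a) ^ 2 ≤ f b - f a - f' a * (b - a) := by
  have hg (x : ℝ) : HasDerivAt (fun x ↦ f x - c / 2 * x ^ 2) (f' x - c * x) x := by
    refine ((hf x).fun_sub ((hasDerivAt_pow 2 x).const_mul (c / 2))).congr_deriv ?_
    push_cast
    ring
  have hg' (x : ℝ) : HasDerivAt (fun x ↦ f' x - c * x) (f'' x - c) x := by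
    simpa using (hf' x).fun_sub ((hasDerivAt_id' x).const_mul c)
  have hconv : ConvexOn ℝ S (fun x ↦ f x - c / 2 * x ^ 2) :=
    convexOn_of_hasDerivWithinAt2_nonneg hS
      (fun x _ ↦ (hg x).continuousAt.continuousWithinAt)
      (fun x _ ↦ (hg x).hasDerivWithinAt) (fun x _ ↦ (hg' x).hasDerivWithinAt)
      (fun x hx ↦ sub_nonneg.2 (hc x (interior_subset hx)))
  have := hconv.add_mul_sub_le_of_hasDerivAt ha hb (hg a)
  linear_combination this

theorem hasDerivAt_log_one_add_exp (x : ℝ) :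
    HasDerivAt (fun x ↦ Real.log (1 + Real.exp x)) (Real.sigmoid x) x := by
  convert ((Real.hasDerivAt_exp x).const_add 1).log (by positivity) using 1
  rw [Real.sigmoid_def, Real.exp_neg]
  field_simp
  ring

theorem sigmoid_mul_one_sub_sigmoid (x : ℝ) :
    Real.sigmoid x * (1 - Real.sigmoid x) = (2 + 2 * Real.cosh x)⁻¹ := by
  rw [← Real.sigmoid_neg, Real.sigmoid_def, Real.sigmoid_def, neg_neg, ← mul_inv, Real.cosh_eq]
  congr 1
  have : Real.exp (-x) * Real.exp x = 1 := by simp [← Real.exp_add]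
  linear_combination this

theorem exp_div_one_add_exp_sq (x : ℝ) :
    Real.exp x / (1 + Real.exp x) ^ 2 = (2 + 2 * Real.cosh x)⁻¹ := by
  rw [Real.cosh_eq, Real.exp_neg]
  field_simp
  ring

/-- The derivative of the sigmoid on `[-r, r]` is smallest at the endpoints. -/
theorem exp_div_one_add_exp_sq_le {x r : ℝ} (h : |x| ≤ r) :
    Real.exp r / (1 + Real.exp r) ^ 2 ≤ Real.sigmoid x * (1 - Real.sigmoid x) := by
  rw [sigmoid_mul_one_sub_sigmoid, exp_div_one_add_exp_sq]
  have := Real.cosh_le_cosh.2 (h.trans (le_abs_self r))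
  have := Real.cosh_pos x
  gcongr

theorem log_one_add_exp_bregman_ge {a b r : ℝ} (ha : |a| ≤ r) (hb : |b| ≤ r) :
    Real.exp r / (1 + Real.exp r) ^ 2 / 2 * (b - a) ^ 2 ≤
      Real.log (1 + Real.exp b) - Real.log (1 + Real.exp a) - Real.sigmoid a * (b - a) :=
  half_mul_sq_le_of_le_deriv2 (convex_Icc (-r) r) hasDerivAt_log_one_add_exp
    Real.hasDerivAt_sigmoid (fun _ hx ↦ exp_div_one_add_exp_sq_le (abs_le.2 hx))
    (abs_le.1 ha) (abs_le.1 hb)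

/-- **Logistic curvature reduction.** If all predictors `⟨X_t, M*⟩` and
`⟨X_t, M* + Δ⟩` lie in `[−2α₀, 2α₀]`, the Bregman divergence of the logistic
loss at `M*` in direction `Δ` is bounded below by
`(c_{α₀}/(2n))·Σ_t ⟨X_t,Δ⟩²` with `c_{α₀} = e^{2α₀}/(1+e^{2α₀})²`. -/
theorem stmt15 (d₁ d₂ n : ℕ) (hn : 1 ≤ n) (α₀ : ℝ) (hα₀ : 0 < α₀)
    (X : Fin n → Matrix (Fin d₁) (Fin d₂) ℝ) (y : Fin n → ℝ)
    (Mstar Δ : Matrix (Fin d₁) (Fin d₂) ℝ)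
    (hM : ∀ t : Fin n, |mip (X t) Mstar| ≤ 2 * α₀)
    (hMΔ : ∀ t : Fin n, |mip (X t) (Mstar + Δ)| ≤ 2 * α₀) :
    logloss X y (Mstar + Δ) - logloss X y Mstar -
        (1 / (n : ℝ)) * ∑ t : Fin n, (lsig (mip (X t) Mstar) - y t) * mip (X t) Δ
      ≥ (Real.exp (2 * α₀) / (1 + Real.exp (2 * α₀)) ^ 2 / (2 * (n : ℝ))) *
          ∑ t : Fin n, mip (X t) Δ ^ 2 := by
  have key (t : Fin n) :
      Real.exp (2 * α₀) / (1 + Real.exp (2 * α₀)) ^ 2 / 2 * mip (X t) Δ ^ 2 ≤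
        (Real.log (1 + Real.exp (mip (X t) (Mstar + Δ))) - y t * mip (X t) (Mstar + Δ)) -
          (Real.log (1 + Real.exp (mip (X t) Mstar)) - y t * mip (X t) Mstar) -
          (lsig (mip (X t) Mstar) - y t) * mip (X t) Δ := by
    have h := log_one_add_exp_bregman_ge (hM t) (hMΔ t)
    have hs : lsig (mip (X t) Mstar) = Real.sigmoid (mip (X t) Mstar) := one_div _
    rw [hs]
    rw [mip_add, add_sub_cancel_left] at h
    rw [mip_add]
    linear_combination h
  have hsum := Finset.sum_le_sum fun t (_ : t ∈ Finset.univ) ↦ key t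
  rw [← Finset.mul_sum, Finset.sum_sub_distrib, Finset.sum_sub_distrib] at hsum
  have hmul := mul_le_mul_of_nonneg_left hsum (by positivity : (0 : ℝ) ≤ 1 / n)
  rw [logloss, logloss, ge_iff_le, ← mul_sub, ← mul_sub]
  refine le_of_eq_of_le ?_ hmul
  ring
end
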